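/- arXiv:1612.01906 — 6 statements merged into one kernel-verified Lean document; each statement's English description precedes it below -/
import Mathlib

section
/- For every k-dimensional linear subspace W of V = K^{2k} there exists a linear subspace W' of V together with spanning vectors w_1, …, w_k of W' such that: (1) each w_ℓ is of the form f_i, g_j, or f_i + g_j for some indices 1 ≤ i, j ≤ k, and no basis vector f_i occurs in more than one of the w_ℓ, and no basis vector g_j occurs in more than one of the w_ℓ; and (2) I_{W'} = I_W, i.e., dim_K(W' ∩ (F_i + G_j)) = dim_K(W ∩ (F_i + G_j)) for all 0 ≤ i, j ≤ k. -/
/-- The index of the basis vector `f_i` (0-based `i`) in `Fin (2*k)`. -/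
def idxF (k : ℕ) (i : Fin k) : Fin (2*k) := ⟨(i : ℕ), by have := i.isLt; omega⟩

/-- The index of the basis vector `g_j` (0-based `j`) in `Fin (2*k)`. -/
def idxG (k : ℕ) (j : Fin k) : Fin (2*k) := ⟨k + (j : ℕ), by have := j.isLt; omega⟩

/-- The basis vector `f_i` of `K^{2k}` (0-based `i`, so `f_i` is the `(i+1)`-st of the
first `k` standard basis vectors). -/
noncomputable def fvec (K : Type*) [Field K] (k : ℕ) (i : Fin k) : Fin (2*k) → K :=
  Pi.single (idxF k i) 1

/-- The basis vector `g_j` of `K^{2k}` (0-based `j`). -/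
noncomputable def gvec (K : Type*) [Field K] (k : ℕ) (j : Fin k) : Fin (2*k) → K :=
  Pi.single (idxG k j) 1

/-- `F_i`: the span of the first `i` standard basis vectors of `K^n`. -/
noncomputable def Fsub (K : Type*) [Field K] (n i : ℕ) : Submodule K (Fin n → K) :=
  Submodule.span K ((fun t : Fin n => Pi.single t (1 : K)) '' { t : Fin n | (t : ℕ) < i })

/-- `G_j`: the span of the standard basis vectors of `K^n` with indices `k, …, k+j-1`
(i.e. of `g_1, …, g_j`). -/
noncomputable def Gsub (K : Type*) [Field K] (n k j : ℕ) : Submodule K (Fin n → K) :=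
  Submodule.span K
    ((fun t : Fin n => Pi.single t (1 : K)) '' { t : Fin n | k ≤ (t : ℕ) ∧ (t : ℕ) < k + j })

/-- The `(i,j)` entry of the incidence matrix of a subspace `W ⊆ K^n`:
`dim_K (W ∩ (F_i + G_j))`. -/
noncomputable def incidence (K : Type*) [Field K] (n k : ℕ)
    (W : Submodule K (Fin n → K)) (i j : ℕ) : ℕ :=
  Module.finrank K ↥(W ⊓ (Fsub K n i ⊔ Gsub K n k j))

open Finset

/-! ### Rank functions of partial permutation matrices -/

/-- The mixed second difference of `D` at `(a, b)`. -/
def mixedDiff (D : ℕ → ℕ → ℤ) (a b : ℕ) : ℤ :=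
  D (a + 1) (b + 1) - D a (b + 1) - (D (a + 1) b - D a b)

theorem sum_mixedDiff_row (D : ℕ → ℕ → ℤ) (h0 : ∀ a, D a 0 = 0) (a J : ℕ) :
    ∑ b ∈ range J, mixedDiff D a b = D (a + 1) J - D a J := by
  unfold mixedDiff
  rw [Finset.sum_range_sub (fun b => D (a + 1) b - D a b), h0, h0]
  ring

theorem sum_mixedDiff (D : ℕ → ℕ → ℤ) (h0 : ∀ a, D a 0 = 0) (h0' : ∀ b, D 0 b = 0)
    (I J : ℕ) : ∑ a ∈ range I, ∑ b ∈ range J, mixedDiff D a b = D I J := by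
  simp_rw [sum_mixedDiff_row D h0]
  rw [Finset.sum_range_sub (fun a => D a J), h0']
  ring

/-- The extension of `d` by a zeroth row and a zeroth column of zeros. -/
def zeroExtend (d : ℕ → ℕ → ℕ) : ℕ → ℕ → ℤ
  | 0, _ => 0
  | _ + 1, 0 => 0
  | a + 1, b + 1 => d a b

theorem zeroExtend_flip (d : ℕ → ℕ → ℕ) (a b : ℕ) :
    zeroExtend (fun x y => d y x) b a = zeroExtend d a b := by
  cases a <;> cases b <;> rfl

theorem zeroExtend_right_zero (d : ℕ → ℕ → ℕ) (a : ℕ) : zeroExtend d a 0 = 0 := by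
  cases a <;> rfl

theorem mixedDiff_zeroExtend_flip (d : ℕ → ℕ → ℕ) (a b : ℕ) :
    mixedDiff (zeroExtend fun x y => d y x) b a = mixedDiff (zeroExtend d) a b := by
  simp only [mixedDiff, zeroExtend_flip]
  ring

theorem eq_of_mixedDiff_eq_one {d : ℕ → ℕ → ℕ} (hstep : ∀ i j, d (i + 1) j ≤ d i j + 1)
    (hnonneg : ∀ a b, 0 ≤ mixedDiff (zeroExtend d) a b) {a b b' : ℕ} (ha : a ≠ 0)
    (hb : mixedDiff (zeroExtend d) a b = 1) (hb' : mixedDiff (zeroExtend d) a b' = 1) :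
    b = b' := by
  by_contra hne
  obtain ⟨i, rfl⟩ := Nat.exists_eq_succ_of_ne_zero ha
  have hsum := sum_mixedDiff_row (zeroExtend d) (zeroExtend_right_zero d) (i + 1) (b + b' + 1)
  have hpair : ∑ x ∈ {b, b'}, mixedDiff (zeroExtend d) (i + 1) x ≤
      ∑ x ∈ range (b + b' + 1), mixedDiff (zeroExtend d) (i + 1) x := by
    apply Finset.sum_le_sum_of_subset_of_nonneg
    · intro x hx
      simp only [mem_insert, mem_singleton] at hx
      simp only [mem_range]
      omega
    · intro x _ _
      exact hnonneg _ _
  rw [Finset.sum_pair hne, hsum] at hpair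
  simp only [Nat.succ_eq_add_one] at hb hb'
  rw [hb, hb'] at hpair
  have := hstep i (b + b')
  simp only [zeroExtend] at hpair
  omega

theorem mixedDiff_le_one {d : ℕ → ℕ → ℕ} (hstep : ∀ i j, d (i + 1) j ≤ d i j + 1)
    (hnonneg : ∀ a b, 0 ≤ mixedDiff (zeroExtend d) a b) {a b : ℕ} (ha : a ≠ 0) :
    mixedDiff (zeroExtend d) a b ≤ 1 := by
  obtain ⟨i, rfl⟩ := Nat.exists_eq_succ_of_ne_zero ha
  have hsum := sum_mixedDiff_row (zeroExtend d) (zeroExtend_right_zero d) (i + 1) (b + 1)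
  have hle := Finset.single_le_sum (f := fun x => mixedDiff (zeroExtend d) (i + 1) x)
    (fun x _ => hnonneg (i + 1) x) (self_mem_range_succ b)
  have := hstep i b
  simp only [zeroExtend] at hsum
  simp only [hsum] at hle
  simp only [Nat.succ_eq_add_one]
  omega

/-- A supermodular function with unit steps and `d 0 0 = 0` counts, on every box, the elements
of a set of pairs in which every nonzero coordinate occurs at most once. -/
theorem exists_finset_card_filter_eq (k : ℕ) (d : ℕ → ℕ → ℕ) (h00 : d 0 0 = 0)
    (hmono : ∀ i j, d i j ≤ d (i + 1) j) (hmono' : ∀ i j, d i j ≤ d i (j + 1))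
    (hsuper : ∀ i j, d (i + 1) j + d i (j + 1) ≤ d (i + 1) (j + 1) + d i j)
    (hstep : ∀ i j, d (i + 1) j ≤ d i j + 1) (hstep' : ∀ i j, d i (j + 1) ≤ d i j + 1) :
    ∃ S : Finset (ℕ × ℕ),
      (∀ s ∈ S, s.1 ≤ k ∧ s.2 ≤ k ∧ (s.1 ≠ 0 ∨ s.2 ≠ 0)) ∧
      (∀ s ∈ S, ∀ s' ∈ S, s.1 ≠ 0 → s.1 = s'.1 → s = s') ∧
      (∀ s ∈ S, ∀ s' ∈ S, s.2 ≠ 0 → s.2 = s'.2 → s = s') ∧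
      (∀ i ≤ k, ∀ j ≤ k, #{s ∈ S | s.1 ≤ i ∧ s.2 ≤ j} = d i j) := by
  set m := mixedDiff (zeroExtend d) with hm
  have hnonneg : ∀ a b, 0 ≤ m a b := by
    intro a b
    cases a with
    | zero => cases b with
      | zero => simp [hm, mixedDiff, zeroExtend]
      | succ b =>
        have := hmono' 0 b
        simp only [hm, mixedDiff, zeroExtend]
        omega
    | succ a => cases b with
      | zero =>
        have := hmono a 0
        simp only [hm, mixedDiff, zeroExtend]
        omega
      | succ b =>
        have := hsuper a b
        simp only [hm, mixedDiff, zeroExtend]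
        omega
  have hm00 : m 0 0 = 0 := by simp [hm, mixedDiff, zeroExtend, h00]
  have hnonneg' : ∀ a b, 0 ≤ mixedDiff (zeroExtend fun x y => d y x) a b := by
    intro a b
    rw [mixedDiff_zeroExtend_flip]
    exact hnonneg b a
  have hle : ∀ a b, m a b ≤ 1 := by
    intro a b
    by_cases ha : a = 0
    · by_cases hb : b = 0
      · rw [ha, hb, hm00]
        exact zero_le_one
      · rw [hm, ← mixedDiff_zeroExtend_flip]
        exact mixedDiff_le_one (fun i j => hstep' j i) hnonneg' hb
    · exact mixedDiff_le_one hstep hnonneg ha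
  refine ⟨{s ∈ range (k + 1) ×ˢ range (k + 1) | m s.1 s.2 = 1}, ?_, ?_, ?_, ?_⟩
  · rintro ⟨a, b⟩ hs
    simp only [mem_filter, mem_product, mem_range] at hs
    refine ⟨by omega, by omega, ?_⟩
    by_contra! h
    simp only at h
    rw [h.1, h.2, hm00] at hs
    omega
  · rintro ⟨a, b⟩ hs ⟨a', b'⟩ hs' ha rfl
    simp only [mem_filter] at hs hs' ha
    rw [eq_of_mixedDiff_eq_one hstep hnonneg ha hs.2 hs'.2]
  · rintro ⟨a, b⟩ hs ⟨a', b'⟩ hs' hb rfl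
    simp only [mem_filter, hm] at hs hs' hb
    rw [← mixedDiff_zeroExtend_flip] at hs hs'
    rw [eq_of_mixedDiff_eq_one (fun i j => hstep' j i) hnonneg' hb hs.2 hs'.2]
  · intro i hi j hj
    have hbox : {s ∈ {s ∈ range (k + 1) ×ˢ range (k + 1) | m s.1 s.2 = 1} |
        s.1 ≤ i ∧ s.2 ≤ j} = {s ∈ range (i + 1) ×ˢ range (j + 1) | m s.1 s.2 = 1} := by
      ext s
      simp only [mem_filter, mem_product, mem_range]
      constructor
      · rintro ⟨⟨_, h⟩, h1, h2⟩
        exact ⟨by omega, h⟩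
      · rintro ⟨⟨h1, h2⟩, h⟩
        exact ⟨⟨by omega, h⟩, by omega, by omega⟩
    have hind : ∀ s ∈ range (i + 1) ×ˢ range (j + 1),
        (if m s.1 s.2 = 1 then (1 : ℤ) else 0) = m s.1 s.2 := by
      intro s _
      have := hnonneg s.1 s.2
      have := hle s.1 s.2
      split_ifs <;> omega
    have hsum := sum_mixedDiff (zeroExtend d) (zeroExtend_right_zero d) (fun _ => rfl)
      (i + 1) (j + 1)
    rw [← Finset.sum_product', ← hm, ← Finset.sum_congr rfl hind, Finset.sum_boole] at hsum
    rw [hbox]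
    exact Int.ofNat_inj.1 hsum

/-! ### Coordinate subspaces -/

section CoordSubspace

variable {K : Type*} [Field K] {n : ℕ}

/-- The vectors supported on `T`. -/
def coordSubspace (K : Type*) [Field K] {n : ℕ} (T : Set (Fin n)) :
    Submodule K (Fin n → K) where
  carrier := {x | ∀ t ∉ T, x t = 0}
  add_mem' hx hy t ht := by simp [hx t ht, hy t ht]
  zero_mem' _ _ := rfl
  smul_mem' c x hx t ht := by simp [hx t ht]

theorem mem_coordSubspace {T : Set (Fin n)} {x : Fin n → K} :
    x ∈ coordSubspace K T ↔ ∀ t ∉ T, x t = 0 := Iff.rfl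

theorem span_single_image (T : Set (Fin n)) :
    Submodule.span K ((fun t : Fin n => Pi.single t (1 : K)) '' T) = coordSubspace K T := by
  apply le_antisymm
  · rw [Submodule.span_le]
    rintro _ ⟨t, ht, rfl⟩ u hu
    have hne : u ≠ t := by
      rintro rfl
      exact hu ht
    simp [hne]
  · intro x hx
    rw [← Finset.univ_sum_single x]
    refine Submodule.sum_mem _ fun t _ => ?_
    by_cases ht : t ∈ T
    · have : Pi.single t (x t) = x t • (Pi.single t 1 : Fin n → K) := by
        rw [← Pi.single_smul, smul_eq_mul, mul_one]
      rw [this]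
      exact Submodule.smul_mem _ _ (Submodule.subset_span ⟨t, ht, rfl⟩)
    · rw [hx t ht, Pi.single_zero]
      exact Submodule.zero_mem _

theorem coordSubspace_mono {T T' : Set (Fin n)} (h : T ⊆ T') :
    coordSubspace K T ≤ coordSubspace K T' :=
  fun _ hx t ht => hx t fun ht' => ht (h ht')

theorem coordSubspace_inf (T T' : Set (Fin n)) :
    coordSubspace K T ⊓ coordSubspace K T' = coordSubspace K (T ∩ T') := by
  ext x
  simp only [Submodule.mem_inf, mem_coordSubspace, Set.mem_inter_iff, not_and_or]
  constructor
  · rintro ⟨h, h'⟩ t (ht | ht)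
    exacts [h t ht, h' t ht]
  · intro h
    exact ⟨fun t ht => h t (.inl ht), fun t ht => h t (.inr ht)⟩

theorem finrank_inf_coordSubspace_mono (W : Submodule K (Fin n → K)) {T T' : Set (Fin n)}
    (h : T ⊆ T') : Module.finrank K ↥(W ⊓ coordSubspace K T) ≤
      Module.finrank K ↥(W ⊓ coordSubspace K T') :=
  Submodule.finrank_mono (inf_le_inf_left W (coordSubspace_mono h))

theorem finrank_inf_coordSubspace_supermodular (W : Submodule K (Fin n → K))
    {A B T U : Set (Fin n)} (hA : A ⊆ T) (hB : B ⊆ T) (hU : A ∩ B = U) :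
    Module.finrank K ↥(W ⊓ coordSubspace K A) + Module.finrank K ↥(W ⊓ coordSubspace K B) ≤
      Module.finrank K ↥(W ⊓ coordSubspace K T) + Module.finrank K ↥(W ⊓ coordSubspace K U) := by
  rw [← Submodule.finrank_sup_add_finrank_inf_eq, ← inf_inf_distrib_left, coordSubspace_inf, hU]
  gcongr
  apply Submodule.finrank_mono
  exact sup_le (inf_le_inf_left W (coordSubspace_mono hA))
    (inf_le_inf_left W (coordSubspace_mono hB))

theorem finrank_inf_coordSubspace_le_add_one (W : Submodule K (Fin n → K))
    {T U : Set (Fin n)} (hsub : ∀ t ∈ T, ∀ t' ∈ T, t ∉ U → t' ∉ U → t = t') :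
    Module.finrank K ↥(W ⊓ coordSubspace K T) ≤
      Module.finrank K ↥(W ⊓ coordSubspace K U) + 1 := by
  by_cases h : T ⊆ U
  · exact (finrank_inf_coordSubspace_mono W h).trans (Nat.le_succ _)
  obtain ⟨t, htT, htU⟩ := Set.not_subset.1 h
  let φ : ↥(W ⊓ coordSubspace K T) →ₗ[K] K :=
    (LinearMap.proj t : (Fin n → K) →ₗ[K] K).domRestrict _
  have hrank := φ.finrank_range_add_finrank_ker
  have hrange : Module.finrank K (LinearMap.range φ) ≤ 1 := by
    simpa using Submodule.finrank_le (LinearMap.range φ)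
  have hker : Module.finrank K (LinearMap.ker φ) ≤
      Module.finrank K ↥(W ⊓ coordSubspace K U) := by
    rw [← Submodule.finrank_map_subtype_eq]
    apply Submodule.finrank_mono
    rintro _ ⟨⟨x, hxW, hxT⟩, hx, rfl⟩
    refine ⟨hxW, fun u hu => ?_⟩
    by_cases huT : u ∈ T
    · rw [hsub u huT t htT hu htU]
      exact hx
    · exact hxT u huT
  omega

/-- Nonzero vectors with disjoint supports meet a coordinate subspace in the span of those of
them that lie in it. -/
theorem finrank_span_inf_coordSubspace {ι : Type*} [Fintype ι] (w : ι → Fin n → K)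
    (hne : ∀ s, ∃ t, w s t ≠ 0) (hdisj : ∀ t s s', w s t ≠ 0 → w s' t ≠ 0 → s = s')
    (T : Set (Fin n)) [DecidablePred fun s => w s ∈ coordSubspace K T] :
    Module.finrank K ↥(Submodule.span K (Set.range w) ⊓ coordSubspace K T) =
      #{s | w s ∈ coordSubspace K T} := by
  have heval : ∀ (c : ι → K) s t, w s t ≠ 0 → (∑ s', c s' • w s') t = c s * w s t := by
    intro c s t hst
    rw [Finset.sum_apply, Finset.sum_eq_single s]
    · rfl
    · intro s' _ hs'
      have : w s' t = 0 := by
        by_contra h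
        exact hs' (hdisj t s' s h hst)
      simp [this]
    · simp
  have hli : LinearIndependent K w := by
    rw [Fintype.linearIndependent_iff]
    intro c hc s
    obtain ⟨t, ht⟩ := hne s
    have := heval c s t ht
    rw [hc] at this
    exact (mul_eq_zero.1 this.symm).resolve_right ht
  have hspan : Submodule.span K (Set.range w) ⊓ coordSubspace K T =
      Submodule.span K (Set.range fun s : {s // w s ∈ coordSubspace K T} => w s) := by
    apply le_antisymm
    · rintro x ⟨hx, hxT⟩
      obtain ⟨c, rfl⟩ := (Submodule.mem_span_range_iff_exists_fun K).1 hx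
      refine Submodule.sum_mem _ fun s _ => ?_
      by_cases hs : w s ∈ coordSubspace K T
      · exact Submodule.smul_mem _ _ (Submodule.subset_span ⟨⟨s, hs⟩, rfl⟩)
      · simp only [mem_coordSubspace, not_forall] at hs
        obtain ⟨t, htT, ht⟩ := hs
        have := hxT t htT
        rw [heval c s t ht] at this
        rw [(mul_eq_zero.1 this).resolve_right ht, zero_smul]
        exact Submodule.zero_mem _
    · rw [Submodule.span_le]
      rintro _ ⟨⟨s, hs⟩, rfl⟩
      exact ⟨Submodule.subset_span ⟨s, rfl⟩, hs⟩
  rw [hspan, ← Fintype.card_subtype]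
  exact finrank_span_eq_card (hli.comp _ Subtype.val_injective)

end CoordSubspace

/-! ### The double flag -/

/-- The indices of the basis vectors `f_1, …, f_i` and `g_1, …, g_j`. -/
def boxIndices (k i j : ℕ) : Set (Fin (2 * k)) :=
  {t | ((t : ℕ) < k ∧ (t : ℕ) < i) ∨ (k ≤ (t : ℕ) ∧ (t : ℕ) < k + j)}

theorem incidence_eq (K : Type*) [Field K] {k i : ℕ} (j : ℕ) (hi : i ≤ k)
    (W : Submodule K (Fin (2 * k) → K)) :
    incidence K (2 * k) k W i j = Module.finrank K ↥(W ⊓ coordSubspace K (boxIndices k i j)) := by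
  have : {t : Fin (2 * k) | (t : ℕ) < i} ∪ {t : Fin (2 * k) | k ≤ (t : ℕ) ∧ (t : ℕ) < k + j} =
      boxIndices k i j := by
    ext t
    simp only [boxIndices, Set.mem_union, Set.mem_ofPred_eq]
    omega
  rw [incidence, Fsub, Gsub, ← Submodule.span_union, ← Set.image_union, this, span_single_image]

/-- The vector `f_a + g_b`, where `f_0 = g_0 = 0`. -/
noncomputable def pairVec (K : Type*) [Field K] (k : ℕ) (s : ℕ × ℕ) : Fin (2 * k) → K := fun t =>
  if ((t : ℕ) < k ∧ (t : ℕ) + 1 = s.1) ∨ (k ≤ (t : ℕ) ∧ (t : ℕ) + 1 = k + s.2 ∧ s.2 ≠ 0)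
  then 1 else 0

theorem pairVec_ne_zero_iff {K : Type*} [Field K] {k : ℕ} {s : ℕ × ℕ} {t : Fin (2 * k)} :
    pairVec K k s t ≠ 0 ↔ ((t : ℕ) < k ∧ (t : ℕ) + 1 = s.1) ∨
      (k ≤ (t : ℕ) ∧ (t : ℕ) + 1 = k + s.2 ∧ s.2 ≠ 0) := by
  unfold pairVec
  split_ifs with h <;> simp [h]

theorem pairVec_eq (K : Type*) [Field K] {k : ℕ} {s : ℕ × ℕ} (h1 : s.1 ≤ k) (h2 : s.2 ≤ k)
    (h0 : s.1 ≠ 0 ∨ s.2 ≠ 0) :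
    (∃ i : Fin k, pairVec K k s = fvec K k i) ∨ (∃ j : Fin k, pairVec K k s = gvec K k j) ∨
      (∃ i j : Fin k, pairVec K k s = fvec K k i + gvec K k j) := by
  obtain ⟨_ | a, _ | b⟩ := s
  · simp at h0
  · refine .inr (.inl ⟨⟨b, h2⟩, ?_⟩)
    ext t
    simp only [pairVec, gvec, idxG, Pi.single_apply, Fin.ext_iff]
    congr 1
    simp only [eq_iff_iff]
    omega
  · refine .inl ⟨⟨a, h1⟩, ?_⟩
    ext t
    simp only at h1
    simp only [pairVec, fvec, idxF, Pi.single_apply, Fin.ext_iff]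
    congr 1
    simp only [eq_iff_iff]
    omega
  · refine .inr (.inr ⟨⟨a, h1⟩, ⟨b, h2⟩, ?_⟩)
    ext t
    simp only at h1
    simp only [pairVec, fvec, gvec, idxF, idxG, Pi.add_apply, Pi.single_apply, Fin.ext_iff]
    split_ifs <;> first | omega | simp

theorem pairVec_mem_coordSubspace_iff {K : Type*} [Field K] {k i j : ℕ} {s : ℕ × ℕ}
    (h1 : s.1 ≤ k) (h2 : s.2 ≤ k) :
    pairVec K k s ∈ coordSubspace K (boxIndices k i j) ↔ s.1 ≤ i ∧ s.2 ≤ j := by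
  rw [mem_coordSubspace]
  constructor
  · intro h
    have h' : ∀ t : Fin (2 * k), pairVec K k s t ≠ 0 → t ∈ boxIndices k i j := fun t ht => by
      by_contra hb
      exact ht (h t hb)
    simp only [pairVec_ne_zero_iff, boxIndices, Set.mem_ofPred_eq] at h'
    constructor
    · by_contra hlt
      have := h' ⟨s.1 - 1, by omega⟩ (.inl ⟨by simp only; omega, by simp only; omega⟩)
      simp only at this
      omega
    · by_contra hlt
      have := h' ⟨k + s.2 - 1, by omega⟩
        (.inr ⟨by simp only; omega, by simp only; omega, by omega⟩)
      simp only at this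
      omega
  · intro h t ht
    by_contra hne
    have := pairVec_ne_zero_iff.1 hne
    simp only [boxIndices, Set.mem_ofPred_eq] at ht
    omega

/-- **Lemma (incidence matrices).** Every `k`-dimensional subspace `W ⊆ K^{2k}` admits a
subspace `W'` with the same incidence matrix, spanned by vectors `w_1, …, w_k`, each of the
form `f_i`, `g_j`, or `f_i + g_j`, in which each `f_i` and each `g_j` occurs at most once. -/
theorem incidence_matrices (K : Type*) [Field K] (k : ℕ) (hk : 0 < k)
    (W : Submodule K (Fin (2*k) → K)) (hW : Module.finrank K ↥W = k) :
    ∃ (W' : Submodule K (Fin (2*k) → K)) (w : Fin k → (Fin (2*k) → K)),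
      Submodule.span K (Set.range w) = W' ∧
      (∀ l : Fin k,
        (∃ i : Fin k, w l = fvec K k i) ∨ (∃ j : Fin k, w l = gvec K k j) ∨
        (∃ i j : Fin k, w l = fvec K k i + gvec K k j)) ∧
      (∀ i : Fin k, ∀ l l' : Fin k, w l (idxF k i) ≠ 0 → w l' (idxF k i) ≠ 0 → l = l') ∧
      (∀ j : Fin k, ∀ l l' : Fin k, w l (idxG k j) ≠ 0 → w l' (idxG k j) ≠ 0 → l = l') ∧
      (∀ i j : ℕ, i ≤ k → j ≤ k →
        incidence K (2*k) k W' i j = incidence K (2*k) k W i j) := by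
  obtain ⟨S, hS, hS1, hS2, hcard⟩ := exists_finset_card_filter_eq k
    (fun i j => Module.finrank K ↥(W ⊓ coordSubspace K (boxIndices k i j)))
    (by
      have : boxIndices k 0 0 = ∅ := by
        refine Set.eq_empty_of_forall_notMem fun t ht => ?_
        simp only [boxIndices, Set.mem_ofPred_eq] at ht
        omega
      rw [this, ← span_single_image, Set.image_empty, Submodule.span_empty, inf_bot_eq,
        finrank_bot])
    (fun i j => finrank_inf_coordSubspace_mono W fun t => by
      simp only [boxIndices, Set.mem_ofPred_eq]; omega)
    (fun i j => finrank_inf_coordSubspace_mono W fun t => by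
      simp only [boxIndices, Set.mem_ofPred_eq]; omega)
    (fun i j => finrank_inf_coordSubspace_supermodular W
      (fun t => by simp only [boxIndices, Set.mem_ofPred_eq]; omega)
      (fun t => by simp only [boxIndices, Set.mem_ofPred_eq]; omega)
      (by ext t; simp only [boxIndices, Set.mem_ofPred_eq, Set.mem_inter_iff]; omega))
    (fun i j => finrank_inf_coordSubspace_le_add_one W fun t ht t' ht' hu hu' => by
      simp only [boxIndices, Set.mem_ofPred_eq] at ht ht' hu hu'; omega)
    (fun i j => finrank_inf_coordSubspace_le_add_one W fun t ht t' ht' hu hu' => by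
      simp only [boxIndices, Set.mem_ofPred_eq] at ht ht' hu hu'; omega)
  have hSk : #S = k := by
    have htop : coordSubspace K (boxIndices k k k) = ⊤ := by
      rw [eq_top_iff]
      intro x _ t ht
      simp only [boxIndices, Set.mem_ofPred_eq] at ht
      omega
    have := hcard k le_rfl k le_rfl
    rwa [htop, inf_top_eq, hW, Finset.filter_true_of_mem fun s hs =>
      ⟨(hS s hs).1, (hS s hs).2.1⟩] at this
  let e : Fin k ≃ S := (S.equivFinOfCardEq hSk).symm
  have hdisj : ∀ t l l', pairVec K k (e l) t ≠ 0 → pairVec K k (e l') t ≠ 0 → l = l' := by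
    intro t l l' h h'
    rw [pairVec_ne_zero_iff] at h h'
    apply e.injective
    apply Subtype.ext
    by_cases ht : (t : ℕ) < k
    · exact hS1 _ (e l).2 _ (e l').2 (by omega) (by omega)
    · exact hS2 _ (e l).2 _ (e l').2 (by omega) (by omega)
  have hform := fun l => pairVec_eq K (hS _ (e l).2).1 (hS _ (e l).2).2.1 (hS _ (e l).2).2.2
  have hne : ∀ l, ∃ t, pairVec K k (e l) t ≠ 0 := by
    intro l
    obtain ⟨h1, h2, h0⟩ := hS _ (e l).2
    simp only [pairVec_ne_zero_iff]
    rcases h0 with h0 | h0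
    · exact ⟨⟨(e l).1.1 - 1, by omega⟩, .inl ⟨by simp only; omega, by simp only; omega⟩⟩
    · exact ⟨⟨k + (e l).1.2 - 1, by omega⟩,
        .inr ⟨by simp only; omega, by simp only; omega, h0⟩⟩
  refine ⟨_, fun l => pairVec K k (e l), rfl, hform, fun i => hdisj _, fun j => hdisj _, ?_⟩
  intro i j hi hj
  classical
  rw [incidence_eq K j hi, incidence_eq K j hi, finrank_span_inf_coordSubspace _ hne hdisj,
    ← hcard i hi j hj]
  refine Finset.card_bij (fun l _ => (e l : ℕ × ℕ)) ?_ ?_ ?_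
  · intro l hl
    rw [mem_filter] at hl ⊢
    exact ⟨(e l).2, (pairVec_mem_coordSubspace_iff (hS _ (e l).2).1 (hS _ (e l).2).2.1).1 hl.2⟩
  · intro l _ l' _ h
    exact e.injective (Subtype.ext h)
  · intro s hs
    rw [mem_filter] at hs
    refine ⟨e.symm ⟨s, hs.1⟩, ?_, by simp⟩
    simp only [mem_filter, mem_univ, true_and, Equiv.apply_symm_apply]
    exact (pairVec_mem_coordSubspace_iff (hS _ hs.1).1 (hS _ hs.1).2.1).2 hs.2
end

section
/- Let W be a k-dimensional linear subspace of V = K^{2k} and let W' be any linear subspace of V. Then there exists C ∈ B with C(W) = W' if and only if I_{W'} = I_W. In other words, the B-orbit of W is exactly the set of all subspaces W' of V with I_{W'} = I_W. -/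
/-- The group `B` of invertible `2k × 2k` matrices that are block-diagonal with two `k × k`
upper-triangular diagonal blocks: all entries below the diagonal, and all entries in the
off-diagonal blocks, vanish. -/
def memB (K : Type*) [Field K] (k : ℕ) (C : Matrix (Fin (2*k)) (Fin (2*k)) K) : Prop :=
  IsUnit C ∧ ∀ i j : Fin (2*k),
    ((j : ℕ) < (i : ℕ) ∨ ((i : ℕ) < k ∧ k ≤ (j : ℕ))) → C i j = 0

section FilteredExtension

variable {K E : Type*} [Field K] [AddCommGroup E] [Module K E]

theorem finrank_map_of_forall_eq_zero (φ : E →ₗ[K] E) (U : Submodule K E)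
    (h : ∀ u ∈ U, φ u = 0 → u = 0) :
    Module.finrank K (U.map φ) = Module.finrank K U := by
  have hinj : Function.Injective (φ.domRestrict U) := by
    rw [← LinearMap.ker_eq_bot, LinearMap.ker_eq_bot']
    intro u hu
    exact Subtype.ext (h u u.2 hu)
  rw [← LinearMap.finrank_range_of_inj hinj, LinearMap.range_domRestrict]

/-- Dimension count behind the extension of filtered maps. -/
theorem finrank_map_inf_filtration {X : ℕ → Submodule K E} (hX0 : X 0 = ⊥)
    {U : Submodule K E} {φ : E →ₗ[K] E} (hφX : ∀ u ∈ U, ∀ i, u ∈ X i ↔ φ u ∈ X i) (i : ℕ) :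
    Module.finrank K ↥(U.map φ ⊓ X i) = Module.finrank K ↥(U ⊓ X i) := by
  have hmap : U.map φ ⊓ X i = (U ⊓ X i).map φ := by
    ext x
    constructor
    · rintro ⟨⟨u, hu, rfl⟩, hx⟩
      exact ⟨u, ⟨hu, (hφX u hu i).2 hx⟩, rfl⟩
    · rintro ⟨u, ⟨hu, hx⟩, rfl⟩
      exact ⟨⟨u, hu, rfl⟩, (hφX u hu i).1 hx⟩
  rw [hmap, finrank_map_of_forall_eq_zero]
  intro u hu h
  have := (hφX u hu.1 0).2 (by simp [h])
  simpa [hX0] using this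

variable [FiniteDimensional K E]

/-- A filtration-preserving linear map on a proper subspace extends, preserving the filtration,
to a strictly larger subspace. -/
theorem exists_filtered_extension_step {X : ℕ → Submodule K E} (hX : Monotone X)
    (hX0 : X 0 = ⊥) {U T T' : Submodule K E} (hUT : U < T) {n : ℕ} (hTn : T ≤ X n)
    (hdim : ∀ i, Module.finrank K ↥(T ⊓ X i) = Module.finrank K ↥(T' ⊓ X i))
    (φ : E →ₗ[K] E) (hφ : ∀ u ∈ U, φ u ∈ T') (hφX : ∀ u ∈ U, ∀ i, u ∈ X i ↔ φ u ∈ X i) :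
    ∃ (U₁ : Submodule K E) (ψ : E →ₗ[K] E), U < U₁ ∧ U₁ ≤ T ∧ (∀ u ∈ U, ψ u = φ u) ∧
      (∀ u ∈ U₁, ψ u ∈ T') ∧ (∀ u ∈ U₁, ∀ i, u ∈ X i ↔ ψ u ∈ X i) := by
  classical
  have hmapT : U.map φ ≤ T' := by
    rintro _ ⟨u, hu, rfl⟩
    exact hφ u hu
  have hex : ∃ i, ¬ T ⊓ X i ≤ U := ⟨n, fun h => hUT.not_ge ((le_inf le_rfl hTn).trans h)⟩
  obtain ⟨i, hi, hmin⟩ : ∃ i, ¬ T ⊓ X i ≤ U ∧ ∀ j < i, T ⊓ X j ≤ U :=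
    ⟨Nat.find hex, Nat.find_spec hex, fun j hj => not_not.1 (Nat.find_min hex hj)⟩
  have hi' : ¬ T' ⊓ X i ≤ U.map φ := by
    intro h
    have h1 : T' ⊓ X i ≤ U.map φ ⊓ X i := le_inf h inf_le_right
    have h2 := Submodule.finrank_mono h1
    rw [finrank_map_inf_filtration hX0 hφX, ← hdim] at h2
    have h3 : U ⊓ X i = T ⊓ X i :=
      Submodule.eq_of_le_of_finrank_le (inf_le_inf_right _ hUT.le) h2
    exact hi (h3 ▸ inf_le_left)
  have hmin' : ∀ j < i, T' ⊓ X j ≤ U.map φ := by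
    intro j hj
    have h1 : U ⊓ X j = T ⊓ X j :=
      le_antisymm (inf_le_inf_right _ hUT.le) (le_inf (hmin j hj) inf_le_right)
    have h2 : U.map φ ⊓ X j = T' ⊓ X j := by
      apply Submodule.eq_of_le_of_finrank_le (inf_le_inf_right _ hmapT)
      rw [finrank_map_inf_filtration hX0 hφX, ← hdim, h1]
    exact h2 ▸ inf_le_left
  obtain ⟨v, ⟨hvT, hvX⟩, hvU⟩ := SetLike.not_le_iff_exists.1 hi
  obtain ⟨v', ⟨hvT', hvX'⟩, hvU'⟩ := SetLike.not_le_iff_exists.1 hi'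
  obtain ⟨ψ, hψ, hψv⟩ := LinearMap.exists_extend_of_notMem (φ.domRestrict U) hvU v'
  have hψU : ∀ u ∈ U, ψ u = φ u := fun u hu => LinearMap.congr_fun hψ ⟨u, hu⟩
  refine ⟨U ⊔ Submodule.span K {v}, ψ, ?_, ?_, hψU, ?_, ?_⟩
  · refine lt_of_le_of_ne le_sup_left fun h => hvU ?_
    rw [h]
    exact Submodule.mem_sup_right (Submodule.mem_span_singleton_self v)
  · exact sup_le hUT.le (by simpa using hvT)
  · intro x hx
    obtain ⟨u, hu, _, hw, rfl⟩ := Submodule.mem_sup.1 hx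
    obtain ⟨c, rfl⟩ := Submodule.mem_span_singleton.1 hw
    rw [map_add, map_smul, hψv, hψU u hu]
    exact T'.add_mem (hφ u hu) (T'.smul_mem c hvT')
  · intro x hx j
    obtain ⟨u, hu, _, hw, rfl⟩ := Submodule.mem_sup.1 hx
    obtain ⟨c, rfl⟩ := Submodule.mem_span_singleton.1 hw
    rw [map_add, map_smul, hψv, hψU u hu]
    rcases eq_or_ne c 0 with rfl | hc
    · simpa using hφX u hu j
    rcases lt_or_ge j i with hj | hj
    · refine iff_of_false (fun h => hvU ?_) (fun h => hvU' ?_)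
      · have h1 : u + c • v ∈ U :=
          hmin j hj ⟨T.add_mem (hUT.le hu) (T.smul_mem c hvT), h⟩
        exact (Submodule.smul_mem_iff _ hc).1 ((Submodule.add_mem_iff_right _ hu).1 h1)
      · have h1 : φ u + c • v' ∈ U.map φ :=
          hmin' j hj ⟨T'.add_mem (hφ u hu) (T'.smul_mem c hvT'), h⟩
        exact (Submodule.smul_mem_iff _ hc).1
          ((Submodule.add_mem_iff_right _ (Submodule.mem_map_of_mem hu)).1 h1)
    · rw [Submodule.add_mem_iff_left _ (Submodule.smul_mem _ c (hX hj hvX)),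
        Submodule.add_mem_iff_left _ (Submodule.smul_mem _ c (hX hj hvX'))]
      exact hφX u hu j

/-- A filtration-preserving linear map on a subspace `U ≤ T` with values in `T'` extends to `T`
when the filtrations induced on `T` and `T'` have equal dimensions. -/
theorem exists_filtered_extension {X : ℕ → Submodule K E} (hX : Monotone X)
    (hX0 : X 0 = ⊥) {U T T' : Submodule K E} (hUT : U ≤ T) {n : ℕ} (hTn : T ≤ X n)
    (hdim : ∀ i, Module.finrank K ↥(T ⊓ X i) = Module.finrank K ↥(T' ⊓ X i))
    (φ : E →ₗ[K] E) (hφ : ∀ u ∈ U, φ u ∈ T') (hφX : ∀ u ∈ U, ∀ i, u ∈ X i ↔ φ u ∈ X i) :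
    ∃ ψ : E →ₗ[K] E, (∀ u ∈ U, ψ u = φ u) ∧ (∀ u ∈ T, ψ u ∈ T') ∧
      (∀ u ∈ T, ∀ i, u ∈ X i ↔ ψ u ∈ X i) := by
  induction U using WellFoundedGT.induction generalizing φ with
  | ind U ih =>
    rcases hUT.eq_or_lt with rfl | hlt
    · exact ⟨φ, fun _ _ => rfl, hφ, hφX⟩
    · obtain ⟨U₁, φ₁, hU₁, hU₁T, hext, h1, h2⟩ :=
        exists_filtered_extension_step hX hX0 hlt hTn hdim φ hφ hφX
      obtain ⟨ψ, hψ, h3, h4⟩ := ih U₁ hU₁ hU₁T φ₁ h1 h2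
      exact ⟨ψ, fun u hu => (hψ u (hU₁.le hu)).trans (hext u hu), h3, h4⟩

/-- Two subspaces in which two filtrations cut out intersections of equal dimensions are
identified by a map respecting both filtrations. -/
theorem exists_bifiltered_map {X Y : ℕ → Submodule K E} (hX : Monotone X) (hX0 : X 0 = ⊥)
    (hY : Monotone Y) (hY0 : Y 0 = ⊥) {n : ℕ} (hXn : X n = ⊤) (W W' : Submodule K E)
    (hdim : ∀ i j, Module.finrank K ↥(W ⊓ Y i ⊓ X j) = Module.finrank K ↥(W' ⊓ Y i ⊓ X j))
    (m : ℕ) :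
    ∃ φ : E →ₗ[K] E, (∀ u ∈ W ⊓ Y m, φ u ∈ W' ⊓ Y m) ∧
      (∀ u ∈ W ⊓ Y m, ∀ j, u ∈ X j ↔ φ u ∈ X j) ∧
      (∀ u ∈ W ⊓ Y m, ∀ i, u ∈ Y i ↔ φ u ∈ Y i) := by
  induction m with
  | zero => exact ⟨0, by simp +contextual [hY0]⟩
  | succ m ih =>
    obtain ⟨φ, h1, h2, h3⟩ := ih
    obtain ⟨ψ, hψ, h4, h5⟩ := exists_filtered_extension hX hX0
      (inf_le_inf_left W (hY m.le_succ)) (n := n) (by simp [hXn]) (hdim (m + 1)) φ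
      (fun u hu => inf_le_inf_left W' (hY m.le_succ) (h1 u hu)) h2
    refine ⟨ψ, h4, h5, fun u hu i => ?_⟩
    rcases Nat.lt_or_ge m i with hi | hi
    · exact iff_of_true (hY hi hu.2) (hY hi (h4 u hu).2)
    have hmap : (W ⊓ Y m).map φ = W' ⊓ Y m := by
      apply Submodule.eq_of_le_of_finrank_le
      · rintro _ ⟨w, hw, rfl⟩
        exact h1 w hw
      · have := finrank_map_inf_filtration hX0 h2 n
        rw [hdim m n] at this
        rw [hXn, inf_top_eq, inf_top_eq] at this
        exact this.ge
    constructor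
    · intro h
      have hu' : u ∈ W ⊓ Y m := ⟨hu.1, hY hi h⟩
      rw [hψ u hu']
      exact (h3 u hu' i).1 h
    · intro h
      have hu' : ψ u ∈ (W ⊓ Y m).map φ := hmap ▸ ⟨(h4 u hu).1, hY hi h⟩
      obtain ⟨w, hw, hwu⟩ := hu'
      have hwT := inf_le_inf_left W (hY m.le_succ) hw
      have hsub : u - w ∈ X 0 := by
        rw [h5 _ (Submodule.sub_mem _ hu hwT) 0, map_sub, hψ w hw, hwu, sub_self]
        exact zero_mem _
      have huw : u = w := by simpa [hX0, sub_eq_zero] using hsub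
      subst huw
      rw [h3 u hw i, ← hψ u hw]
      exact h

end FilteredExtension

section CoordinateFiltrations

variable (K : Type*) [Field K] {n : ℕ}

/-- Vectors whose coordinates outside `S` vanish. -/
def supportedOn (S : Fin n → Prop) : Submodule K (Fin n → K) where
  carrier := {x | ∀ t, ¬ S t → x t = 0}
  add_mem' := fun ha hb t ht => by simp [ha t ht, hb t ht]
  zero_mem' := fun _ _ => rfl
  smul_mem' := fun c x hx t ht => by simp [hx t ht]

variable {K}

theorem mem_supportedOn {S : Fin n → Prop} {x : Fin n → K} :
    x ∈ supportedOn K S ↔ ∀ t, ¬ S t → x t = 0 := Iff.rfl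

theorem supportedOn_mono {S T : Fin n → Prop} (h : ∀ t, S t → T t) :
    supportedOn K S ≤ supportedOn K T := fun _ hx t ht => hx t (mt (h t) ht)

theorem supportedOn_inf (S T : Fin n → Prop) :
    supportedOn K S ⊓ supportedOn K T = supportedOn K (fun t => S t ∧ T t) := by
  ext x
  simp only [Submodule.mem_inf, mem_supportedOn]
  constructor
  · rintro ⟨h1, h2⟩ t ht
    by_cases hS : S t
    · exact h2 t fun hT => ht ⟨hS, hT⟩
    · exact h1 t hS
  · exact fun h => ⟨fun t ht => h t fun h' => ht h'.1, fun t ht => h t fun h' => ht h'.2⟩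

theorem Fsub_sup_Gsub (k i j : ℕ) :
    Fsub K n i ⊔ Gsub K n k j =
      supportedOn K (fun t : Fin n => (t : ℕ) < i ∨ k ≤ (t : ℕ) ∧ (t : ℕ) < k + j) := by
  have hb : (fun t : Fin n => Pi.single t (1 : K)) = Pi.basisFun K (Fin n) := by
    ext t
    simp
  ext x
  rw [Fsub, Gsub, ← Submodule.span_union, ← Set.image_union, hb, Module.Basis.mem_span_image,
    mem_supportedOn]
  simp only [Set.subset_def, Finset.mem_coe, Finsupp.mem_support_iff, Pi.basisFun_repr,
    Set.mem_union, Set.mem_ofPred_eq]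
  exact forall_congr' fun t => not_imp_comm

/-- The coordinate projection onto the coordinates in `S`. -/
noncomputable def coordProj (K : Type*) [Field K] (S : Fin n → Prop) :
    (Fin n → K) →ₗ[K] (Fin n → K) := by
  classical
  exact LinearMap.pi fun t => if S t then LinearMap.proj t else 0

theorem coordProj_apply_of_mem {S : Fin n → Prop} {t : Fin n} (ht : S t) (x : Fin n → K) :
    coordProj K S x t = x t := by
  simp [coordProj, ht]

theorem coordProj_apply_of_notMem {S : Fin n → Prop} {t : Fin n} (ht : ¬ S t)
    (x : Fin n → K) : coordProj K S x t = 0 := by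
  simp [coordProj, ht]

theorem coordProj_mem_supportedOn_iff {S : Fin n → Prop} {i : ℕ} {x : Fin n → K} :
    coordProj K S x ∈ supportedOn K (fun t : Fin n => (t : ℕ) < i) ↔
      x ∈ supportedOn K (fun t : Fin n => S t → (t : ℕ) < i) := by
  simp only [mem_supportedOn]
  refine forall_congr' fun t => ?_
  by_cases ht : S t
  · simp [coordProj_apply_of_mem ht, ht]
  · simp [coordProj_apply_of_notMem ht, ht]

/-- A map `φ` compatible with the coordinate filtration on the `S`-block induces on that block
a filtered automorphism. -/
theorem exists_filtered_block_map (S : Fin n → Prop) (W : Submodule K (Fin n → K))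
    (φ : (Fin n → K) →ₗ[K] (Fin n → K))
    (hφ : ∀ u ∈ W, ∀ i : ℕ, u ∈ supportedOn K (fun t : Fin n => S t → (t : ℕ) < i) ↔
      φ u ∈ supportedOn K (fun t : Fin n => S t → (t : ℕ) < i)) :
    ∃ α : (Fin n → K) →ₗ[K] (Fin n → K),
      (∀ u ∈ W, α (coordProj K S u) = coordProj K S (φ u)) ∧
      (∀ x ∈ supportedOn K S, α x ∈ supportedOn K S) ∧
      (∀ x ∈ supportedOn K S, ∀ i : ℕ, x ∈ supportedOn K (fun t : Fin n => (t : ℕ) < i) ↔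
        α x ∈ supportedOn K (fun t : Fin n => (t : ℕ) < i)) := by
  set p := coordProj K S with hp
  have hpS : ∀ x, p x ∈ supportedOn K S := fun x t ht => coordProj_apply_of_notMem ht x
  have hzero : supportedOn K (fun t : Fin n => (t : ℕ) < 0) = ⊥ := by
    ext x
    simp [mem_supportedOn, funext_iff]
  let P := W.map p
  let f : W →ₗ[K] P := p.submoduleMap W
  have hf : Function.Surjective f := p.submoduleMap_surjective W
  obtain ⟨s, hs⟩ := f.exists_rightInverse_of_surjective (LinearMap.range_eq_top.2 hf)
  obtain ⟨α₀, hα₀⟩ := LinearMap.exists_extend ((p ∘ₗ φ ∘ₗ W.subtype) ∘ₗ s)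
  have hα : ∀ u ∈ W, α₀ (p u) = p (φ u) := by
    intro u hu
    let y : P := ⟨p u, Submodule.mem_map_of_mem hu⟩
    have h1 : α₀ (p u) = p (φ (s y)) := LinearMap.congr_fun hα₀ y
    have h2 : p (s y : Fin n → K) = p u := congrArg Subtype.val (LinearMap.congr_fun hs y)
    have h3 : p (φ ((s y : Fin n → K) - u)) ∈ supportedOn K (fun t : Fin n => (t : ℕ) < 0) := by
      rw [hp, coordProj_mem_supportedOn_iff, ← hφ _ (W.sub_mem (s y).2 hu),
        ← coordProj_mem_supportedOn_iff, ← hp, map_sub, h2, sub_self]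
      exact zero_mem _
    rw [hzero, Submodule.mem_bot, map_sub, map_sub, sub_eq_zero] at h3
    rw [h1, h3]
  obtain ⟨α, h1, h2, h3⟩ := exists_filtered_extension
    (X := fun i => supportedOn K (fun t : Fin n => (t : ℕ) < i))
    (fun a b hab => supportedOn_mono fun t ht => ht.trans_le hab) hzero
    (U := P) (T := supportedOn K S) (T' := supportedOn K S) (n := n)
    (by rintro _ ⟨u, -, rfl⟩; exact hpS u)
    (fun x _ t ht => absurd t.2 ht) (fun _ => rfl) α₀
    (by rintro _ ⟨u, hu, rfl⟩; rw [hα u hu]; exact hpS _)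
    (by
      rintro _ ⟨u, hu, rfl⟩ i
      rw [hα u hu, hp, coordProj_mem_supportedOn_iff, coordProj_mem_supportedOn_iff, hφ u hu])
  exact ⟨α, fun u hu => (h1 _ (Submodule.mem_map_of_mem hu)).trans (hα u hu), h2, h3⟩

end CoordinateFiltrations

section Orbits

variable {K : Type*} [Field K] {k : ℕ}

theorem finrank_map_inf_eq_of_injective {E : Type*} [AddCommGroup E] [Module K E]
    [FiniteDimensional K E] (f : E →ₗ[K] E) (hf : Function.Injective f) (W Z : Submodule K E)
    (hZ : Z.map f ≤ Z) :
    Module.finrank K ↥(W.map f ⊓ Z) = Module.finrank K ↥(W ⊓ Z) := by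
  have h0 : ∀ V : Submodule K E, Module.finrank K (V.map f) = Module.finrank K V := fun V =>
    finrank_map_of_forall_eq_zero f V fun u _ h => hf (h.trans (map_zero f).symm)
  have hZ' : Z.map f = Z := Submodule.eq_of_le_of_finrank_eq hZ (h0 Z)
  rw [← h0 (W ⊓ Z), Submodule.map_inf f hf, hZ']

/-- The incidence matrix is invariant under `B`. -/
theorem incidence_map_of_memB {C : Matrix (Fin (2 * k)) (Fin (2 * k)) K} (hC : memB K k C)
    (W : Submodule K (Fin (2 * k) → K)) (i j : ℕ) :
    incidence K (2 * k) k (W.map (Matrix.toLin' C)) i j = incidence K (2 * k) k W i j := by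
  unfold incidence
  rw [Fsub_sup_Gsub]
  refine finrank_map_inf_eq_of_injective (Matrix.toLin' C) ?_ W _ ?_
  · exact (Matrix.mulVec_injective_iff_isUnit (A := C)).2 hC.1
  · rintro _ ⟨x, hx, rfl⟩ t ht
    rw [Matrix.toLin'_apply, Matrix.mulVec, dotProduct]
    refine Finset.sum_eq_zero fun s _ => ?_
    by_cases hs : (s : ℕ) < i ∨ k ≤ (s : ℕ) ∧ (s : ℕ) < k + j
    · rw [hC.2 t s (by omega), zero_mul]
    · rw [hx s hs, mul_zero]

/-- Filtered automorphisms of the two blocks assemble to an element of `B`. -/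
theorem memB_of_block_maps (α β : (Fin (2 * k) → K) →ₗ[K] (Fin (2 * k) → K))
    (hα : ∀ x ∈ supportedOn K (fun t : Fin (2 * k) => (t : ℕ) < k),
      α x ∈ supportedOn K (fun t : Fin (2 * k) => (t : ℕ) < k))
    (hαi : ∀ x ∈ supportedOn K (fun t : Fin (2 * k) => (t : ℕ) < k), ∀ i : ℕ,
      x ∈ supportedOn K (fun t : Fin (2 * k) => (t : ℕ) < i) ↔
        α x ∈ supportedOn K (fun t : Fin (2 * k) => (t : ℕ) < i))
    (hβ : ∀ x ∈ supportedOn K (fun t : Fin (2 * k) => k ≤ (t : ℕ)),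
      β x ∈ supportedOn K (fun t : Fin (2 * k) => k ≤ (t : ℕ)))
    (hβi : ∀ x ∈ supportedOn K (fun t : Fin (2 * k) => k ≤ (t : ℕ)), ∀ i : ℕ,
      x ∈ supportedOn K (fun t : Fin (2 * k) => (t : ℕ) < i) ↔
        β x ∈ supportedOn K (fun t : Fin (2 * k) => (t : ℕ) < i)) :
    memB K k (LinearMap.toMatrix' (α ∘ₗ coordProj K (fun t : Fin (2 * k) => (t : ℕ) < k) +
      β ∘ₗ coordProj K (fun t : Fin (2 * k) => k ≤ (t : ℕ)))) := by
  set p := coordProj K (fun t : Fin (2 * k) => (t : ℕ) < k) with hp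
  set q := coordProj K (fun t : Fin (2 * k) => k ≤ (t : ℕ)) with hq
  have hpS : ∀ x, p x ∈ supportedOn K (fun t : Fin (2 * k) => (t : ℕ) < k) :=
    fun x t ht => coordProj_apply_of_notMem ht x
  have hqS : ∀ x, q x ∈ supportedOn K (fun t : Fin (2 * k) => k ≤ (t : ℕ)) :=
    fun x t ht => coordProj_apply_of_notMem ht x
  constructor
  · rw [← Matrix.mulVec_injective_iff_isUnit]
    change Function.Injective (Matrix.mulVecLin _)
    rw [← Matrix.toLin'_apply', Matrix.toLin'_toMatrix', ← LinearMap.ker_eq_bot,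
      LinearMap.ker_eq_bot']
    intro x hx
    have hx' : ∀ t, α (p x) t + β (q x) t = 0 := fun t => congrFun hx t
    have h1 : p x ∈ supportedOn K (fun t : Fin (2 * k) => (t : ℕ) < 0) := by
      rw [hαi _ (hpS x)]
      intro t _
      by_cases ht : (t : ℕ) < k
      · simpa [hβ _ (hqS x) t (not_le.2 ht)] using hx' t
      · exact hα _ (hpS x) t ht
    have h2 : q x ∈ supportedOn K (fun t : Fin (2 * k) => (t : ℕ) < 0) := by
      rw [hβi _ (hqS x)]
      intro t _
      by_cases ht : k ≤ (t : ℕ)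
      · simpa [hα _ (hpS x) t (not_lt.2 ht)] using hx' t
      · exact hβ _ (hqS x) t ht
    ext t
    by_cases ht : (t : ℕ) < k
    · rw [← coordProj_apply_of_mem (S := fun t : Fin (2 * k) => (t : ℕ) < k) ht x]
      exact h1 t (Nat.not_lt_zero _)
    · rw [← coordProj_apply_of_mem (S := fun t : Fin (2 * k) => k ≤ (t : ℕ)) (not_lt.1 ht) x]
      exact h2 t (Nat.not_lt_zero _)
  · intro i j hij
    rw [LinearMap.toMatrix'_apply]
    simp only [LinearMap.add_apply, LinearMap.comp_apply, Pi.add_apply]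
    have hsingle : ∀ t : Fin (2 * k), ¬ (t : ℕ) < j + 1 →
        (Pi.single j 1 : Fin (2 * k) → K) t = 0 := fun t ht =>
      Pi.single_eq_of_ne (by rintro rfl; omega) _
    by_cases hj : (j : ℕ) < k
    · have hq0 : q (Pi.single j 1) = 0 := by
        ext t
        by_cases ht : k ≤ (t : ℕ)
        · rw [hq, coordProj_apply_of_mem ht]
          exact Pi.single_eq_of_ne (by rintro rfl; omega) _
        · rw [hq, coordProj_apply_of_notMem ht]
          rfl
      have h1 : p (Pi.single j 1) ∈ supportedOn K (fun t : Fin (2 * k) => (t : ℕ) < j + 1) := by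
        rw [hp, coordProj_mem_supportedOn_iff]
        exact fun t ht => hsingle t fun h => ht fun _ => h
      rw [hαi _ (hpS _)] at h1
      have h2 := h1 i (by omega)
      simp_all [Pi.single]
    · have hp0 : p (Pi.single j 1) = 0 := by
        ext t
        by_cases ht : (t : ℕ) < k
        · rw [hp, coordProj_apply_of_mem ht]
          exact Pi.single_eq_of_ne (by rintro rfl; omega) _
        · rw [hp, coordProj_apply_of_notMem ht]
          rfl
      have h1 : β (q (Pi.single j 1)) i = 0 := by
        rcases hij with hij | hij
        · have h1 : q (Pi.single j 1) ∈
              supportedOn K (fun t : Fin (2 * k) => (t : ℕ) < j + 1) := by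
            rw [hq, coordProj_mem_supportedOn_iff]
            exact fun t ht => hsingle t fun h => ht fun _ => h
          rw [hβi _ (hqS _)] at h1
          exact h1 i (by omega)
        · exact hβ _ (hqS _) i (by omega)
      simp_all [Pi.single]

/-- The coordinate filtration of the `S`-block, pulled back to `K^n` and started at `0`. -/
def pulledBackFiltration (K : Type*) [Field K] {n : ℕ} (S : Fin n → Prop) :
    ℕ → Submodule K (Fin n → K)
  | 0 => ⊥
  | i + 1 => supportedOn K (fun t : Fin n => S t → (t : ℕ) < i)

theorem pulledBackFiltration_monotone {n : ℕ} (S : Fin n → Prop) :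
    Monotone (pulledBackFiltration K S) := by
  refine monotone_nat_of_le_succ fun i => ?_
  cases i with
  | zero => exact bot_le
  | succ i => exact supportedOn_mono fun t h hS => (h hS).trans i.lt_succ_self

theorem pulledBackFiltration_eq_top {n : ℕ} (S : Fin n → Prop) :
    pulledBackFiltration K S (n + 1) = ⊤ :=
  top_unique fun _ _ t ht => absurd (fun _ => t.2) ht

theorem exists_memB_map_eq (W W' : Submodule K (Fin (2 * k) → K))
    (h : ∀ i j : ℕ, i ≤ k → j ≤ k →
      incidence K (2 * k) k W' i j = incidence K (2 * k) k W i j) :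
    ∃ C : Matrix (Fin (2 * k)) (Fin (2 * k)) K, memB K k C ∧
      Submodule.map (Matrix.toLin' C) W = W' := by
  let Y := pulledBackFiltration K (fun t : Fin (2 * k) => (t : ℕ) < k)
  let X := pulledBackFiltration K (fun t : Fin (2 * k) => k ≤ (t : ℕ))
  have hYX : ∀ i j, Y (i + 1) ⊓ X (j + 1) = supportedOn K (fun t : Fin (2 * k) =>
      (t : ℕ) < min i k ∨ k ≤ (t : ℕ) ∧ (t : ℕ) < k + min (j - k) k) := by
    intro i j
    change supportedOn K _ ⊓ supportedOn K _ = _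
    rw [supportedOn_inf]
    congr 1
    ext t
    have := t.2
    omega
  have hY0 : Y 0 = ⊥ := rfl
  have hX0 : X 0 = ⊥ := rfl
  have hdim : ∀ i j, Module.finrank K ↥(W ⊓ Y i ⊓ X j) =
      Module.finrank K ↥(W' ⊓ Y i ⊓ X j) := by
    rintro (_ | i) (_ | j)
    · rw [hY0, inf_bot_eq, inf_bot_eq]
    · rw [hY0, inf_bot_eq, inf_bot_eq]
    · rw [hX0, inf_bot_eq, inf_bot_eq]
    · rw [inf_assoc, inf_assoc, hYX]
      have hij := h (min i k) (min (j - k) k) (min_le_right _ _) (min_le_right _ _)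
      rw [incidence, incidence, Fsub_sup_Gsub] at hij
      exact hij.symm
  have hYtop : Y (2 * k + 1) = ⊤ := pulledBackFiltration_eq_top _
  obtain ⟨φ, h1, h2, h3⟩ := exists_bifiltered_map (pulledBackFiltration_monotone _) rfl
    (pulledBackFiltration_monotone _) rfl (pulledBackFiltration_eq_top _) W W' hdim (2 * k + 1)
  rw [hYtop, inf_top_eq] at h1 h2 h3
  rw [inf_top_eq] at h1
  obtain ⟨α, hα, hα1, hα2⟩ := exists_filtered_block_map
    (fun t : Fin (2 * k) => (t : ℕ) < k) W φ fun u hu i => h3 u hu (i + 1)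
  obtain ⟨β, hβ, hβ1, hβ2⟩ := exists_filtered_block_map
    (fun t : Fin (2 * k) => k ≤ (t : ℕ)) W φ fun u hu i => h2 u hu (i + 1)
  refine ⟨_, memB_of_block_maps α β hα1 hα2 hβ1 hβ2, ?_⟩
  have hWφ : ∀ u ∈ W, (α ∘ₗ coordProj K (fun t : Fin (2 * k) => (t : ℕ) < k) +
      β ∘ₗ coordProj K (fun t : Fin (2 * k) => k ≤ (t : ℕ))) u = φ u := by
    intro u hu
    rw [LinearMap.add_apply, LinearMap.comp_apply, LinearMap.comp_apply, hα u hu, hβ u hu]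
    ext t
    rw [Pi.add_apply]
    rcases lt_or_ge (t : ℕ) k with ht | ht
    · rw [coordProj_apply_of_mem ht,
        coordProj_apply_of_notMem (S := fun t : Fin (2 * k) => k ≤ (t : ℕ)) (not_le.2 ht),
        add_zero]
    · rw [coordProj_apply_of_notMem (S := fun t : Fin (2 * k) => (t : ℕ) < k) (not_lt.2 ht),
        coordProj_apply_of_mem ht, zero_add]
  rw [Matrix.toLin'_toMatrix']
  have hmap : ∀ x, x ∈ W.map (α ∘ₗ coordProj K (fun t : Fin (2 * k) => (t : ℕ) < k) +
      β ∘ₗ coordProj K (fun t : Fin (2 * k) => k ≤ (t : ℕ))) → x ∈ W' := by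
    rintro _ ⟨u, hu, rfl⟩
    rw [hWφ u hu]
    exact h1 u hu
  apply Submodule.eq_of_le_of_finrank_eq hmap
  rw [finrank_map_of_forall_eq_zero]
  · have := hdim (2 * k + 1) (2 * k + 1)
    rwa [hYtop, show X (2 * k + 1) = ⊤ from pulledBackFiltration_eq_top _, inf_top_eq,
      inf_top_eq, inf_top_eq, inf_top_eq] at this
  · intro u hu h0
    rw [hWφ u hu] at h0
    exact (h2 u hu 0).2 (h0 ▸ zero_mem _)

end Orbits

/-- **Lemma (orbits on G(k,2k)).** The `B`-orbit of a `k`-dimensional subspace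
`W ⊆ K^{2k}` is exactly the set of subspaces `W'` with the same incidence matrix as `W`. -/
theorem grass_k2k_orbits (K : Type*) [Field K] (k : ℕ) (hk : 0 < k)
    (W W' : Submodule K (Fin (2*k) → K)) (hW : Module.finrank K ↥W = k) :
    (∃ C : Matrix (Fin (2*k)) (Fin (2*k)) K, memB K k C ∧
        Submodule.map (Matrix.toLin' C) W = W') ↔
      (∀ i j : ℕ, i ≤ k → j ≤ k →
        incidence K (2*k) k W' i j = incidence K (2*k) k W i j) := by
  constructor
  · rintro ⟨C, hC, rfl⟩ i j _ _
    exact incidence_map_of_memB hC W i j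
  · exact exists_memB_map_eq W W'
end

section
/- The action of B on the set of all k-dimensional linear subspaces of V = K^{2k} has only finitely many orbits; that is, the quotient of the set of k-dimensional subspaces of V by the equivalence relation 'W ~ W' iff there exists C ∈ B with C(W) = W'' is a finite set. -/
namespace BOrbits

variable {K : Type*} [Field K] {k : ℕ}

theorem memB_one : memB K k 1 := by
  refine ⟨isUnit_one, fun i j h => Matrix.one_apply_ne ?_⟩
  rintro rfl
  omega

theorem memB_mul {C D : Matrix (Fin (2*k)) (Fin (2*k)) K} (hC : memB K k C) (hD : memB K k D) :
    memB K k (C * D) := by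
  refine ⟨hC.1.mul hD.1, fun i j h => ?_⟩
  rw [Matrix.mul_apply]
  refine Finset.sum_eq_zero fun l _ => ?_
  by_cases hl : (l : ℕ) < (i : ℕ) ∨ ((i : ℕ) < k ∧ k ≤ (l : ℕ))
  · rw [hC.2 i l hl, zero_mul]
  · rw [hD.2 l j (by omega), mul_zero]

theorem memB_diag_ne_zero {C : Matrix (Fin (2*k)) (Fin (2*k)) K} (hC : memB K k C)
    (i : Fin (2*k)) : C i i ≠ 0 := by
  have hdet : C.det ≠ 0 := ((Matrix.isUnit_iff_isUnit_det C).1 hC.1).ne_zero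
  rw [Matrix.det_of_isUpperTriangular fun i j h => hC.2 i j (Or.inl h)] at hdet
  exact Finset.prod_ne_zero_iff.1 hdet i (Finset.mem_univ i)

/-- The subspace of vectors whose coordinates of index at least `r` vanish. -/
def initial (K : Type*) [Field K] (k r : ℕ) : Submodule K (Fin (2*k) → K) where
  carrier := {x | ∀ i : Fin (2*k), r ≤ (i : ℕ) → x i = 0}
  zero_mem' := fun _ _ => rfl
  add_mem' := fun hx hy i hi => by simp [hx i hi, hy i hi]
  smul_mem' := fun c x hx i hi => by simp [hx i hi]

theorem mulVec_mem_initial {C : Matrix (Fin (2*k)) (Fin (2*k)) K} (hC : memB K k C) {r : ℕ}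
    {x : Fin (2*k) → K} (hx : x ∈ initial K k r) : C.mulVec x ∈ initial K k r := by
  intro i hi
  change ∑ l, C i l * x l = 0
  refine Finset.sum_eq_zero fun l _ => ?_
  rcases lt_or_ge (l : ℕ) r with hl | hl
  · rw [hC.2 i l (by omega), zero_mul]
  · rw [hx l hl, mul_zero]

theorem mulVec_apply_top {C : Matrix (Fin (2*k)) (Fin (2*k)) K} (hC : memB K k C)
    (r : Fin (2*k)) {x : Fin (2*k) → K} (hx : x ∈ initial K k ((r : ℕ) + 1)) :
    C.mulVec x r = C r r * x r := by
  change ∑ l, C r l * x l = C r r * x r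
  refine Finset.sum_eq_single r (fun l _ hl => ?_) (by simp)
  have hl' : (l : ℕ) ≠ (r : ℕ) := fun h => hl (Fin.ext h)
  rcases lt_or_ge (l : ℕ) (r : ℕ) with h | h
  · rw [hC.2 r l (Or.inl h), zero_mul]
  · rw [hx l (by omega), mul_zero]

/-- A vector with last nonzero coordinate `p`, supported in the block of `p`, can be moved to the
standard basis vector at `p` by an element of `B` fixing every vector with zero coordinate
at `p`. -/
theorem exists_memB_mulVec_eq_single (p : Fin (2*k)) {w : Fin (2*k) → K} (hp : w p ≠ 0)
    (hw : ∀ i : Fin (2*k), ((p : ℕ) < (i : ℕ) ∨ ((i : ℕ) < k ∧ k ≤ (p : ℕ))) → w i = 0) :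
    ∃ C : Matrix (Fin (2*k)) (Fin (2*k)) K, memB K k C ∧ C.mulVec w = Pi.single p 1 ∧
      ∀ x : Fin (2*k) → K, x p = 0 → C.mulVec x = x := by
  set u : Fin (2*k) → K := (w p)⁻¹ • (Pi.single p 1 - w) with hu
  set C : Matrix (Fin (2*k)) (Fin (2*k)) K := 1 + Matrix.vecMulVec u (Pi.single p 1) with hC
  have hmul : ∀ x : Fin (2*k) → K, C.mulVec x = x + x p • u := by
    intro x
    rw [hC, Matrix.add_mulVec, Matrix.one_mulVec, Matrix.vecMulVec_mulVec]
    simp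
  have hzero : ∀ i j : Fin (2*k),
      ((j : ℕ) < (i : ℕ) ∨ ((i : ℕ) < k ∧ k ≤ (j : ℕ))) → C i j = 0 := by
    intro i j h
    have hij : i ≠ j := by rintro rfl; omega
    rw [hC, Matrix.add_apply, Matrix.one_apply_ne hij, Matrix.vecMulVec_apply, zero_add]
    by_cases hj : j = p
    · subst hj
      simp [hu, hij, hw i h]
    · simp [hj]
  refine ⟨C, ⟨?_, hzero⟩, ?_, fun x hx => by rw [hmul, hx, zero_smul, add_zero]⟩
  · rw [Matrix.isUnit_iff_isUnit_det,
      Matrix.det_of_isUpperTriangular fun i j h => hzero i j (Or.inl h), isUnit_iff_ne_zero]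
    refine Finset.prod_ne_zero_iff.2 fun i _ => ?_
    by_cases hi : i = p
    · subst hi
      have : C i i = (w i)⁻¹ := by
        simp [hC, hu, Matrix.vecMulVec_apply]
        field_simp
        ring
      rw [this]
      exact inv_ne_zero hp
    · simp [hC, Matrix.vecMulVec_apply, hi]
  · rw [hmul, hu, smul_inv_smul₀ hp]
    abel

/-- The standard basis vectors, together with the sums of one vector from each block. -/
def normalVectors (K : Type*) [Field K] (k : ℕ) : Set (Fin (2*k) → K) :=
  Set.range (fun i => Pi.single i 1) ∪
    {x | ∃ i j : Fin (2*k), (i : ℕ) < k ∧ k ≤ (j : ℕ) ∧ x = Pi.single i 1 + Pi.single j 1}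

theorem finite_normalVectors : (normalVectors K k).Finite := by
  refine (Set.finite_range _).union ((Set.finite_range
    fun q : Fin (2*k) × Fin (2*k) => (Pi.single q.1 1 + Pi.single q.2 1 : Fin (2*k) → K)).subset ?_)
  rintro _ ⟨i, j, _, _, rfl⟩
  exact ⟨(i, j), rfl⟩

theorem normalVectors_apply {x : Fin (2*k) → K} (hx : x ∈ normalVectors K k) {i l : Fin (2*k)}
    (hi : (i : ℕ) < k) (hl : (l : ℕ) < k) (hxi : x i ≠ 0) : x l = if l = i then 1 else 0 := by
  rcases hx with ⟨m, rfl⟩ | ⟨m, n, hm, hn, rfl⟩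
  · have : i = m := by
      by_contra h
      simp [h] at hxi
    subst this
    simp [Pi.single_apply]
  · have h₁ : i ≠ n := by rintro rfl; omega
    have h₂ : l ≠ n := by rintro rfl; omega
    have : i = m := by
      by_contra h
      simp [h, h₁] at hxi
    subst this
    simp [Pi.single_apply, h₂]

/-- Modulo the span of a set of normal vectors, the first-block coordinates occurring in the set
can be eliminated. -/
theorem exists_sub_mem_span_forall_eq_zero {S : Set (Fin (2*k) → K)}
    (hS : S ⊆ normalVectors K k) (w : Fin (2*k) → K) :
    ∃ y ∈ Submodule.span K S, ∀ l : Fin (2*k), (l : ℕ) < k → (∃ s ∈ S, s l ≠ 0) →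
      (w - y) l = 0 := by
  classical
  have hch : ∀ i : Fin (2*k), ∃ t ∈ Submodule.span K S, ((i : ℕ) < k → (∃ s ∈ S, s i ≠ 0) →
      ∀ l : Fin (2*k), (l : ℕ) < k → t l = if l = i then 1 else 0) ∧
      (¬ ((i : ℕ) < k ∧ ∃ s ∈ S, s i ≠ 0) → t = 0) := by
    intro i
    by_cases h : (i : ℕ) < k ∧ ∃ s ∈ S, s i ≠ 0
    · obtain ⟨hi, s, hs, hsi⟩ := h
      exact ⟨s, Submodule.subset_span hs,
        fun _ _ l hl => normalVectors_apply (hS hs) hi hl hsi,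
        fun h => absurd ⟨hi, s, hs, hsi⟩ h⟩
    · exact ⟨0, zero_mem _, fun h₁ h₂ => absurd ⟨h₁, h₂⟩ h, fun _ => rfl⟩
  choose t ht ht₁ ht₀ using hch
  refine ⟨∑ i, w i • t i, Submodule.sum_mem _ fun i _ => Submodule.smul_mem _ _ (ht i), ?_⟩
  intro l hl hs
  rw [Pi.sub_apply, Finset.sum_apply, Finset.sum_eq_single l]
  · simp [ht₁ l hl hs l hl]
  · intro i _ hi
    by_cases h : (i : ℕ) < k ∧ ∃ s ∈ S, s i ≠ 0
    · simp [ht₁ i h.1 h.2 l hl, hi.symm]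
    · simp [ht₀ i h]
  · simp

theorem map_span_sup_span_singleton {C : Matrix (Fin (2*k)) (Fin (2*k)) K}
    {S : Set (Fin (2*k) → K)} (hS : ∀ s ∈ S, C.mulVec s = s) (w : Fin (2*k) → K) :
    (Submodule.span K S ⊔ Submodule.span K {w}).map (Matrix.toLin' C) =
      Submodule.span K S ⊔ Submodule.span K {C.mulVec w} := by
  have hfix : (Matrix.toLin' C) '' S = S := by
    refine (Set.image_congr fun s hs => ?_).trans (Set.image_id S)
    simpa using hS s hs
  rw [Submodule.map_sup, Submodule.map_span, Submodule.map_span, hfix, Set.image_singleton,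
    Matrix.toLin'_apply]

theorem exists_memB_map_span_sup_eq {S : Set (Fin (2*k) → K)} (hS : S ⊆ normalVectors K k)
    (r : Fin (2*k)) (hSr : ∀ s ∈ S, s ∈ initial K k r) {w : Fin (2*k) → K}
    (hw : w ∈ initial K k ((r : ℕ) + 1)) (hwr : w r ≠ 0) :
    ∃ C : Matrix (Fin (2*k)) (Fin (2*k)) K, memB K k C ∧ ∃ T ⊆ normalVectors K k,
      (Submodule.span K S ⊔ Submodule.span K {w}).map (Matrix.toLin' C) =
        Submodule.span K T := by
  have hsingle : ∀ i : Fin (2*k), (Pi.single i 1 : Fin (2*k) → K) ∈ normalVectors K k :=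
    fun i => Or.inl ⟨i, rfl⟩
  have hinsert : ∀ v : Fin (2*k) → K,
      Submodule.span K S ⊔ Submodule.span K {v} = Submodule.span K (insert v S) := fun v => by
    rw [Submodule.span_insert, sup_comm]
  rcases lt_or_ge (r : ℕ) k with hr | hr
  · obtain ⟨C, hC, hCw, hfix⟩ := exists_memB_mulVec_eq_single r hwr fun i hi => hw i (by omega)
    refine ⟨C, hC, insert (Pi.single r 1) S, Set.insert_subset (hsingle r) hS, ?_⟩
    rw [map_span_sup_span_singleton (fun s hs => hfix s (hSr s hs r le_rfl)), hCw, hinsert]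
  obtain ⟨y, hy, hy₀⟩ := exists_sub_mem_span_forall_eq_zero hS w
  have hyr : y ∈ initial K k r := Submodule.span_le.2 hSr hy
  have hsup : Submodule.span K S ⊔ Submodule.span K {w} =
      Submodule.span K S ⊔ Submodule.span K {w - y} := by
    apply le_antisymm <;> refine sup_le le_sup_left ?_ <;>
      rw [Submodule.span_singleton_le_iff_mem]
    · rw [← sub_add_cancel w y]
      exact add_mem (Submodule.mem_sup_right (by
        rw [sub_add_cancel]; exact Submodule.mem_span_singleton_self _))
        (Submodule.mem_sup_left hy)
    · exact sub_mem (Submodule.mem_sup_right (Submodule.mem_span_singleton_self _))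
        (Submodule.mem_sup_left hy)
  set a : Fin (2*k) → K := fun i => if (i : ℕ) < k then (w - y) i else 0 with ha
  set b : Fin (2*k) → K := fun i => if (i : ℕ) < k then 0 else (w - y) i with hb
  have hab : w - y = a + b := by
    ext i
    by_cases h : (i : ℕ) < k <;> simp [ha, hb, h]
  have hbr : b r ≠ 0 := by
    simpa [hb, hr.not_gt, hyr r le_rfl] using hwr
  obtain ⟨C, hC, hCb, hfix⟩ := exists_memB_mulVec_eq_single r hbr fun i hi => by
    by_cases h : (i : ℕ) < k
    · simp [hb, h]
    · simp [hb, h, hw i (by omega), hyr i (by omega)]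
  have hCw : C.mulVec (w - y) = a + Pi.single r 1 := by
    rw [hab, Matrix.mulVec_add, hCb, hfix a (by simp [ha, hr.not_gt])]
  have hCmap : (Submodule.span K S ⊔ Submodule.span K {w}).map (Matrix.toLin' C) =
      Submodule.span K S ⊔ Submodule.span K {a + Pi.single r 1} := by
    rw [hsup, map_span_sup_span_singleton (fun s hs => hfix s (hSr s hs r le_rfl)), hCw]
  by_cases ha₀ : a = 0
  · refine ⟨C, hC, insert (Pi.single r 1) S, Set.insert_subset (hsingle r) hS, ?_⟩
    rw [hCmap, ha₀, zero_add, hinsert]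
  classical
  obtain ⟨i₀, hi₀⟩ := Function.ne_iff.1 ha₀
  obtain ⟨p, hp, hmax⟩ := Finset.exists_max_image (Finset.univ.filter fun i => a i ≠ 0) id
    ⟨i₀, by simpa using hi₀⟩
  have hap : a p ≠ 0 := by simpa using hp
  have hpk : (p : ℕ) < k := by
    by_contra h
    exact hap (by simp [ha, h])
  obtain ⟨D, hD, hDa, hDfix⟩ := exists_memB_mulVec_eq_single p hap fun i hi => by
    by_contra h
    have := Fin.le_def.1 (hmax i (by simpa using h))
    simp only [id] at this
    omega
  have hpr : r ≠ p := by rintro rfl; omega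
  have hSp : ∀ s ∈ S, s p = 0 := fun s hs => by
    by_contra h
    exact hap (by simpa [ha, hpk] using hy₀ p hpk ⟨s, hs, h⟩)
  refine ⟨D * C, memB_mul hD hC, insert (Pi.single p 1 + Pi.single r 1) S,
    Set.insert_subset (Or.inr ⟨p, r, hpk, hr, rfl⟩) hS, ?_⟩
  rw [Matrix.toLin'_mul, Submodule.map_comp, hCmap,
    map_span_sup_span_singleton (fun s hs => hDfix s (hSp s hs)), Matrix.mulVec_add, hDa,
    hDfix _ (by simp [hpr.symm]), hinsert]

/-- Every subspace is moved by `B` to one spanned by normal vectors. -/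
theorem exists_memB_map_eq_span (r : ℕ) (hr : r ≤ 2*k) (W : Submodule K (Fin (2*k) → K))
    (hW : W ≤ initial K k r) :
    ∃ C : Matrix (Fin (2*k)) (Fin (2*k)) K, memB K k C ∧ ∃ S ⊆ normalVectors K k,
      W.map (Matrix.toLin' C) = Submodule.span K S := by
  induction r generalizing W with
  | zero =>
    refine ⟨1, memB_one, ∅, Set.empty_subset _, ?_⟩
    have : W = ⊥ := (Submodule.eq_bot_iff W).2 fun x hx => funext fun i => hW hx i i.val.zero_le
    rw [this, Submodule.map_bot, Submodule.span_empty]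
  | succ n ih =>
    by_cases hWn : W ≤ initial K k n
    · exact ih (by omega) W hWn
    obtain ⟨w, hw, hwn⟩ := SetLike.not_le_iff_exists.1 hWn
    set p : Fin (2*k) := ⟨n, hr⟩
    have hmem : ∀ x ∈ W, x p = 0 → x ∈ initial K k n := fun x hx hxp i hi => by
      rcases hi.eq_or_lt with h | h
      · rwa [show i = p from Fin.ext h.symm]
      · exact hW hx i h
    have hwp : w p ≠ 0 := fun h => hwn (hmem w hw h)
    obtain ⟨C, hC, S, hS, hCS⟩ := ih (by omega) (W ⊓ initial K k n) inf_le_right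
    have hsup : W = (W ⊓ initial K k n) ⊔ Submodule.span K {w} := by
      refine le_antisymm (fun x hx => ?_)
        (sup_le inf_le_left ((Submodule.span_singleton_le_iff_mem _ _).2 hw))
      have hx' : x - (x p / w p) • w ∈ W := sub_mem hx (W.smul_mem _ hw)
      rw [← sub_add_cancel x ((x p / w p) • w)]
      exact add_mem (Submodule.mem_sup_left ⟨hx', hmem _ hx' (by simp [hwp])⟩)
        (Submodule.mem_sup_right
          (Submodule.smul_mem _ _ (Submodule.mem_span_singleton_self w)))
    have hSn : ∀ s ∈ S, s ∈ initial K k p := fun s hs => by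
      have hs' := Submodule.subset_span (R := K) hs
      rw [← hCS] at hs'
      obtain ⟨x, hx, rfl⟩ := hs'
      exact mulVec_mem_initial hC hx.2
    have hCw : C.mulVec w p ≠ 0 := by
      rw [mulVec_apply_top hC p (hW hw)]
      exact mul_ne_zero (memB_diag_ne_zero hC p) hwp
    obtain ⟨D, hD, T, hT, hDT⟩ :=
      exists_memB_map_span_sup_eq hS p hSn (mulVec_mem_initial hC (hW hw)) hCw
    refine ⟨D * C, memB_mul hD hC, T, hT, ?_⟩
    rw [Matrix.toLin'_mul, Submodule.map_comp, hsup, Submodule.map_sup, hCS, Submodule.map_span,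
      Set.image_singleton, Matrix.toLin'_apply, hDT]

end BOrbits

open BOrbits in
/-- **Finitely many `B`-orbits.** The quotient of the set of `k`-dimensional subspaces of
`K^{2k}` by the relation `W ~ W'` iff `W' = C(W)` for some `C ∈ B` is a finite set. -/
theorem finitely_many_B_orbits (K : Type*) [Field K] (k : ℕ) (hk : 0 < k) :
    Finite (Quot fun (W W' : {W : Submodule K (Fin (2*k) → K) // Module.finrank K ↥W = k}) =>
      ∃ C : Matrix (Fin (2*k)) (Fin (2*k)) K, memB K k C ∧
        Submodule.map (Matrix.toLin' C) (W : Submodule K (Fin (2*k) → K)) =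
          (W' : Submodule K (Fin (2*k) → K))) := by
  have hnf : ∀ W : {W : Submodule K (Fin (2*k) → K) // Module.finrank K ↥W = k},
      ∃ S ∈ 𝒫 normalVectors K k, ∃ C : Matrix (Fin (2*k)) (Fin (2*k)) K, memB K k C ∧
        W.1.map (Matrix.toLin' C) = Submodule.span K S := fun W => by
    obtain ⟨C, hC, S, hS, h⟩ := exists_memB_map_eq_span (2*k) le_rfl W.1
      fun x _ i hi => absurd i.2 hi.not_gt
    exact ⟨S, hS, C, hC, h⟩
  choose N hN C hC hCN using hnf
  have hrank : ∀ W, Module.finrank K (Submodule.span K (N W)) = k := fun W => by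
    have hinj : Function.Injective (Matrix.toLin' (C W)) :=
      Matrix.mulVec_injective_of_isUnit (hC W).1
    rw [← hCN W]
    exact ((Submodule.equivMapOfInjective _ hinj W.1).finrank_eq).symm.trans W.2
  have : Finite (𝒫 normalVectors K k) := finite_normalVectors.finite_subsets
  refine Finite.of_injective
    (fun q => (⟨N q.out, hN q.out⟩ : 𝒫 normalVectors K k)) fun q q' h => ?_
  have hNN : N q.out = N q'.out := congrArg Subtype.val h
  rw [← q.out_eq, ← q'.out_eq]
  refine (Quot.sound (b := ⟨Submodule.span K (N q.out), hrank q.out⟩)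
    ⟨C q.out, hC q.out, hCN q.out⟩).trans (Quot.sound ⟨C q'.out, hC q'.out, ?_⟩).symm
  exact (hCN q'.out).trans (congrArg (Submodule.span K) hNN.symm)
end

section
/- Let k be a nonnegative integer and let a, b_1, b_2 be nonnegative integers satisfying k·a ≥ b_1 + b_2. Then the vector α = a·e_0 − b_1·e_1 − b_2·e_2 ∈ ℝ^3 is a nonnegative linear combination of the vectors e_0, e_1, e_2 and the vectors β_m = e_0 − m·e_1 − (k−m)·e_2 for 0 ≤ m ≤ k; that is, there exist nonnegative real numbers c_0, c_1, c_2 and d_0, …, d_k with α = c_0 e_0 + c_1 e_1 + c_2 e_2 + Σ_{m=0}^{k} d_m β_m. -/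
/-- The standard basis vectors of `ℝ³`. -/
noncomputable def e (i : Fin 3) : Fin 3 → ℝ := Pi.single i 1

/-- **Lemma (dual cone for two points).** If `k·a ≥ b₁ + b₂` with `a, b₁, b₂, k ≥ 0`, then
`α = a·e₀ − b₁·e₁ − b₂·e₂` is a nonnegative combination of `e₀, e₁, e₂` and the vectors
`β_m = e₀ − m·e₁ − (k−m)·e₂` for `0 ≤ m ≤ k`. -/
theorem dual_cone_two_points (k a b₁ b₂ : ℕ) (h : b₁ + b₂ ≤ k * a) :
    ∃ (c₀ c₁ c₂ : ℝ) (d : Fin (k+1) → ℝ),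
      0 ≤ c₀ ∧ 0 ≤ c₁ ∧ 0 ≤ c₂ ∧ (∀ m, 0 ≤ d m) ∧
      ((a : ℝ) • e 0 - (b₁ : ℝ) • e 1 - (b₂ : ℝ) • e 2) =
        c₀ • e 0 + c₁ • e 1 + c₂ • e 2 +
          ∑ m : Fin (k+1),
            d m • (e 0 - ((m : ℕ) : ℝ) • e 1 - ((k - (m : ℕ) : ℕ) : ℝ) • e 2) := by
  have hb : (k : ℝ) * (b₁ / k) = b₁ ∧ (k : ℝ) * (b₂ / k) = b₂ ∧
      (b₁ : ℝ) / k + b₂ / k ≤ a := by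
    rcases Nat.eq_zero_or_pos k with rfl | hk
    · obtain ⟨rfl, rfl⟩ : b₁ = 0 ∧ b₂ = 0 := by omega
      simp
    · have hk' : (0 : ℝ) < k := by exact_mod_cast hk
      refine ⟨by field_simp, by field_simp, ?_⟩
      rw [← add_div, div_le_iff₀ hk', mul_comm]
      exact_mod_cast h
  obtain ⟨h₁, h₂, h₀⟩ := hb
  refine ⟨a - (b₁ / k + b₂ / k), 0, 0,
    fun m ↦ (if m = Fin.last k then (b₁ : ℝ) / k else 0) + (if m = 0 then (b₂ : ℝ) / k else 0),
    sub_nonneg.2 h₀, le_rfl, le_rfl, fun m ↦ by positivity, ?_⟩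
  simp only [add_smul, Finset.sum_add_distrib, ite_smul, zero_smul, Finset.sum_ite_eq',
    Finset.mem_univ, if_true, Fin.val_last, Fin.val_zero, Nat.sub_self,
    Nat.sub_zero, Nat.cast_zero]
  linear_combination (norm := module) h₁ • e 1 + h₂ • e 2
end

section
/- Let r be an integer with 2 ≤ r ≤ 6, let a be a nonnegative integer, and let b_1, …, b_r be nonnegative integers such that for every pair of distinct indices i ≠ j one has b_i + b_j + Σ_{k=1}^{r} b_k ≤ 2a (equivalently, 2a ≥ 2b_i + 2b_j + Σ_{k ≠ i,j} b_k). Then 2·Σ_{k=1}^{r} b_k ≤ 3a; moreover, if a is odd then 2·Σ_{k=1}^{r} b_k ≤ 3a − 1. -/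
/-- Averaging `b i + b j + ∑ t, b t ≤ c` over the cyclically consecutive pairs `(i, i + 1)`. -/
theorem add_two_mul_sum_le_of_pair_add_sum_le {r : ℕ} (hr : 2 ≤ r) {c : ℕ} {b : Fin r → ℕ}
    (h : ∀ i j : Fin r, i ≠ j → b i + b j + ∑ t, b t ≤ c) :
    (r + 2) * ∑ t, b t ≤ r * c := by
  obtain ⟨n, rfl⟩ := Nat.exists_eq_add_of_le' hr
  have hsum := Finset.sum_le_sum fun i (_ : i ∈ Finset.univ) => h i (i + 1) (by simp)
  have hshift : ∑ i, b (i + 1) = ∑ i, b i := Equiv.sum_comp (Equiv.addRight 1) b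
  simp only [Finset.sum_add_distrib, hshift, Finset.sum_const, Finset.card_univ,
    Fintype.card_fin, smul_eq_mul] at hsum
  linarith

/-- **Arithmetic inequality for curves on quadrics.** Let `2 ≤ r ≤ 6`, `a ≥ 0`, and
`b_1, …, b_r ≥ 0` be integers such that `2a ≥ 2b_i + 2b_j + Σ_{t ≠ i,j} b_t`
(equivalently `b_i + b_j + Σ_t b_t ≤ 2a`) for all `i ≠ j`. Then `2 Σ b_t ≤ 3a`, and if
`a` is odd then `2 Σ b_t ≤ 3a − 1`. -/
theorem quadric_curve_inequality (r : ℕ) (hr1 : 2 ≤ r) (hr2 : r ≤ 6)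
    (a : ℕ) (b : Fin r → ℕ)
    (h : ∀ i j : Fin r, i ≠ j → b i + b j + ∑ t, b t ≤ 2 * a) :
    2 * ∑ t, b t ≤ 3 * a ∧ (Odd a → 2 * ∑ t, b t ≤ 3 * a - 1) := by
  have key := add_two_mul_sum_le_of_pair_add_sum_le hr1 h
  have hle : 2 * ∑ t, b t ≤ 3 * a := by
    generalize ∑ t, b t = S at key ⊢
    clear h b
    interval_cases r <;> omega
  refine ⟨hle, ?_⟩
  rintro ⟨k, rfl⟩
  omega
end

section
/- Let V and W be finite-dimensional real vector spaces, φ : V → W a surjective linear map, and B a symmetric bilinear form on V. Let C ⊆ V, Γ ⊆ V, Σ ⊆ W and E ⊆ W be convex cones containing 0, and suppose E = φ(C) + Σ and φ(Γ) = Σ. Let D ∈ V satisfy: (0) B(D, D) = 0; (1) B(D, γ) ≥ 0 for every γ ∈ C, and every γ ∈ C with B(D, γ) = 0 is a real scalar multiple of D; (2) B(D, c) = 0 for every c in the kernel of φ; and (3) B(D, c) > 0 for every nonzero c ∈ Γ. Then for every decomposition φ(D) = α + β with α, β ∈ E, both α and β are real scalar multiples of φ(D); in particular, if φ(D) ≠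 0 then φ(D) spans an extremal ray of E. -/
open Pointwise

/-- If `f` is nonnegative on `C` and vanishes there only along `ℝ D`, and is positive on
`Γ \ {0}`, then every point of `φ(C) + φ(Γ)` lifts to a vector on which `f` is nonnegative
and vanishes only along `ℝ D`. -/
theorem exists_lift_of_mem_image_add_image {V W : Type*}
    [AddCommGroup V] [Module ℝ V] [AddCommGroup W] [Module ℝ W]
    (φ : V →ₗ[ℝ] W) (f : V →ₗ[ℝ] ℝ) {C Γ : Set V} {D : V}
    (hC : ∀ γ ∈ C, 0 ≤ f γ ∧ (f γ = 0 → ∃ t : ℝ, γ = t • D))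
    (hΓ : ∀ c ∈ Γ, c ≠ 0 → 0 < f c) {w : W} (hw : w ∈ φ '' C + φ '' Γ) :
    ∃ v, φ v = w ∧ 0 ≤ f v ∧ (f v = 0 → ∃ t : ℝ, v = t • D) := by
  obtain ⟨_, ⟨a, ha, rfl⟩, _, ⟨g, hg, rfl⟩, rfl⟩ := hw
  obtain ⟨ha0, haD⟩ := hC a ha
  refine ⟨a + g, map_add φ a g, ?_⟩
  rcases eq_or_ne g 0 with rfl | hg0
  · simpa using ⟨ha0, haD⟩
  · have hpos : 0 < f (a + g) := by
      rw [map_add]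
      exact add_pos_of_nonneg_of_pos ha0 (hΓ g hg hg0)
    exact ⟨hpos.le, fun h => absurd h hpos.ne'⟩

/-- **Abstract extremality lemma (after Coskun–Lesieutre–Ottem).** Let `φ : V → W` be a
surjective linear map of finite-dimensional real vector spaces, `B` a symmetric bilinear
form on `V`, and `C, Γ ⊆ V`, `Sig, E ⊆ W` convex cones containing `0` with
`E = φ(C) + Sig` and `φ(Γ) = Sig`. Suppose `D ∈ V` satisfies:
(0) `B(D,D) = 0`;
(1) `B(D,γ) ≥ 0` for all `γ ∈ C`, and any `γ ∈ C` with `B(D,γ) = 0` is a multiple of `D`;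
(2) `B(D,c) = 0` for all `c ∈ ker φ`;
(3) `B(D,c) > 0` for all nonzero `c ∈ Γ`.
Then in every decomposition `φ(D) = α + β` with `α, β ∈ E`, both `α` and `β` are scalar
multiples of `φ(D)`; in particular if `φ(D) ≠ 0` then `φ(D)` spans an extremal ray of `E`. -/
theorem extremal_ray_pushforward {V W : Type*}
    [AddCommGroup V] [Module ℝ V] [FiniteDimensional ℝ V]
    [AddCommGroup W] [Module ℝ W] [FiniteDimensional ℝ W]
    (φ : V →ₗ[ℝ] W) (hφ : Function.Surjective φ)
    (B : V →ₗ[ℝ] V →ₗ[ℝ] ℝ) (hB : ∀ x y, B x y = B y x)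
    (C Γ : ConvexCone ℝ V) (Sig E : ConvexCone ℝ W)
    (hC0 : (0 : V) ∈ C) (hΓ0 : (0 : V) ∈ Γ) (hS0 : (0 : W) ∈ Sig) (hE0 : (0 : W) ∈ E)
    (hE : (E : Set W) = (φ '' (C : Set V)) + (Sig : Set W))
    (hΓ : φ '' (Γ : Set V) = (Sig : Set W))
    (D : V)
    (h0 : B D D = 0)
    (h1 : ∀ γ ∈ C, 0 ≤ B D γ ∧ (B D γ = 0 → ∃ t : ℝ, γ = t • D))
    (h2 : ∀ c : V, φ c = 0 → B D c = 0)
    (h3 : ∀ c ∈ Γ, c ≠ 0 → 0 < B D c) :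
    ∀ α β : W, α ∈ E → β ∈ E → φ D = α + β →
      (∃ s : ℝ, α = s • φ D) ∧ (∃ t : ℝ, β = t • φ D) := by
  intro α β hα hβ hαβ
  rw [← SetLike.mem_coe, hE, ← hΓ] at hα hβ
  obtain ⟨a, rfl, ha0, haD⟩ := exists_lift_of_mem_image_add_image φ (B D) h1 h3 hα
  obtain ⟨b, rfl, hb0, hbD⟩ := exists_lift_of_mem_image_add_image φ (B D) h1 h3 hβ
  have hsum : B D a + B D b = 0 := by
    have h := h2 (D - (a + b)) (by rw [map_sub, map_add, hαβ, sub_self])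
    rw [map_sub, map_add, h0] at h
    linarith
  obtain ⟨s, rfl⟩ := haD (by linarith)
  obtain ⟨t, rfl⟩ := hbD (by linarith)
  exact ⟨⟨s, map_smul φ s D⟩, ⟨t, map_smul φ t D⟩⟩
end
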